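/- Let q be a complex number with |q| < 1. Then for every z ∈ ℂ one has the Taylor expansion ∏_{n=0}^∞ (1 − z q^n) = ∑_{n=0}^∞ ((−1)^n · q^{n(n−1)/2} / (q;q)_n) · z^n, where the series on the right converges (absolutely) for all z ∈ ℂ and (q;q)_n = ∏_{k=1}^{n} (1 − q^k) ≠ 0 for all n. -/

import Mathlib

open Filter Topology

/-- The `n`-th Taylor coefficient `(-1)ⁿ q^{n(n-1)/2} / (q;q)_n` of `z ↦ (z;q)_∞`. -/
noncomputable def qEulerCoeff (q : ℂ) (n : ℕ) : ℂ :=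
  (-1 : ℂ) ^ n * q ^ (n * (n - 1) / 2) / ∏ k ∈ Finset.range n, (1 - q ^ (k + 1))

lemma one_sub_pow_succ_ne_zero {q : ℂ} (hq : ‖q‖ < 1) (k : ℕ) : 1 - q ^ (k + 1) ≠ 0 := by
  intro h
  have hlt : ‖q ^ (k + 1)‖ < 1 := by
    rw [norm_pow]
    exact pow_lt_one₀ (norm_nonneg q) hq k.succ_ne_zero
  rw [← sub_eq_zero.mp h, norm_one] at hlt
  exact lt_irrefl _ hlt

lemma qEulerCoeff_zero (q : ℂ) : qEulerCoeff q 0 = 1 := by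
  simp [qEulerCoeff]

lemma qEulerCoeff_succ (q : ℂ) (n : ℕ) :
    qEulerCoeff q (n + 1) = -q ^ n / (1 - q ^ (n + 1)) * qEulerCoeff q n := by
  have hexp : (n + 1) * (n + 1 - 1) / 2 = n * (n - 1) / 2 + n := by
    rw [← Finset.sum_range_id, ← Finset.sum_range_id, Finset.sum_range_succ]
  rw [qEulerCoeff, qEulerCoeff, hexp, Finset.prod_range_succ, pow_add q, pow_succ (-1 : ℂ),
    div_mul_div_comm]
  congr 1 <;> ring

lemma summable_norm_qEulerCoeff_mul_pow {q : ℂ} (hq : ‖q‖ < 1) (z : ℂ) :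
    Summable fun n : ℕ => ‖qEulerCoeff q n * z ^ n‖ := by
  have hpow : Tendsto (fun n : ℕ => q ^ n) atTop (𝓝 0) :=
    tendsto_pow_atTop_nhds_zero_of_norm_lt_one hq
  have hratio : Tendsto (fun n : ℕ => ‖-q ^ n / (1 - q ^ (n + 1)) * z‖) atTop (𝓝 0) := by
    have hden : Tendsto (fun n : ℕ => 1 - q ^ (n + 1)) atTop (𝓝 (1 - 0)) :=
      ((tendsto_add_atTop_iff_nat 1).mpr hpow).const_sub 1
    simpa using ((hpow.neg.div hden (by simp)).mul_const z).norm
  refine summable_of_ratio_norm_eventually_le (r := 1 / 2) (by norm_num) ?_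
  filter_upwards [hratio.eventually_le_const (by norm_num : (0 : ℝ) < 1 / 2)] with n hn
  have hstep : qEulerCoeff q (n + 1) * z ^ (n + 1) =
      -q ^ n / (1 - q ^ (n + 1)) * z * (qEulerCoeff q n * z ^ n) := by
    rw [qEulerCoeff_succ]
    ring
  rw [norm_norm, norm_norm, hstep, norm_mul]
  gcongr

lemma tsum_qEulerCoeff_eq_one_sub_mul {q : ℂ} (hq : ‖q‖ < 1) (z : ℂ) :
    ∑' n, qEulerCoeff q n * z ^ n = (1 - z) * ∑' n, qEulerCoeff q n * (z * q) ^ n := by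
  have hz := (summable_norm_qEulerCoeff_mul_pow hq z).of_norm
  have hzq := (summable_norm_qEulerCoeff_mul_pow hq (z * q)).of_norm
  have hdiff : ∑' n, qEulerCoeff q n * z ^ n - ∑' n, qEulerCoeff q n * (z * q) ^ n =
      -z * ∑' n, qEulerCoeff q n * (z * q) ^ n := by
    rw [← hz.tsum_sub hzq, (hz.sub hzq).tsum_eq_zero_add, ← tsum_mul_left]
    simp only [pow_zero, sub_self, zero_add]
    refine tsum_congr fun n => ?_
    have hne := one_sub_pow_succ_ne_zero hq n
    rw [qEulerCoeff_succ]
    field_simp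
    ring
  linear_combination hdiff

lemma tsum_qEulerCoeff_eq_prod_mul {q : ℂ} (hq : ‖q‖ < 1) (z : ℂ) (N : ℕ) :
    ∑' n, qEulerCoeff q n * z ^ n =
      (∏ k ∈ Finset.range N, (1 - z * q ^ k)) * ∑' n, qEulerCoeff q n * (z * q ^ N) ^ n := by
  induction N with
  | zero => simp
  | succ N ih =>
    rw [ih, tsum_qEulerCoeff_eq_one_sub_mul hq (z * q ^ N), Finset.prod_range_succ, pow_succ q N,
      mul_assoc z, mul_assoc]

lemma tendsto_tsum_qEulerCoeff_mul_pow {q : ℂ} (hq : ‖q‖ < 1) (z : ℂ) :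
    Tendsto (fun N : ℕ => ∑' n, qEulerCoeff q n * (z * q ^ N) ^ n) atTop (𝓝 1) := by
  have hpow : Tendsto (fun N : ℕ => z * q ^ N) atTop (𝓝 0) := by
    simpa using (tendsto_pow_atTop_nhds_zero_of_norm_lt_one hq).const_mul z
  have hlim : ∑' n, qEulerCoeff q n * (0 : ℂ) ^ n = 1 := by
    rw [tsum_eq_single 0 fun n hn => by simp [hn]]
    simp [qEulerCoeff_zero]
  rw [← hlim]
  refine tendsto_tsum_of_dominated_convergence (summable_norm_qEulerCoeff_mul_pow hq z)
    (fun n => (hpow.pow n).const_mul _) (Eventually.of_forall fun N n => ?_)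
  rw [norm_mul, norm_mul, norm_pow, norm_pow, norm_mul, norm_pow]
  gcongr
  exact mul_le_of_le_one_right (norm_nonneg z) (pow_le_one₀ (norm_nonneg q) hq.le)

lemma multipliable_one_sub_mul_pow {q : ℂ} (hq : ‖q‖ < 1) (z : ℂ) :
    Multipliable fun n : ℕ => 1 - z * q ^ n := by
  have hsum : Summable fun n : ℕ => ‖-(z * q ^ n)‖ := by
    simpa [norm_mul, norm_pow] using
      (summable_geometric_of_lt_one (norm_nonneg q) hq).mul_left ‖z‖
  simpa [sub_eq_add_neg] using multipliable_one_add_of_summable hsum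

lemma tsum_qEulerCoeff_eq_tprod {q : ℂ} (hq : ‖q‖ < 1) (z : ℂ) :
    ∑' n, qEulerCoeff q n * z ^ n = ∏' n : ℕ, (1 - z * q ^ n) := by
  have hlim := (multipliable_one_sub_mul_pow hq z).hasProd.tendsto_prod_nat.mul
    (tendsto_tsum_qEulerCoeff_mul_pow hq z)
  simp only [← tsum_qEulerCoeff_eq_prod_mul hq z, mul_one] at hlim
  exact tendsto_nhds_unique tendsto_const_nhds hlim


/-- Let `q : ℂ` with `|q| < 1`.  Then for every `z : ℂ` one has the
Taylor expansion
`∏_{n=0}^∞ (1 - z qⁿ) = ∑_{n=0}^∞ ((-1)ⁿ q^{n(n-1)/2} / (q;q)_n) zⁿ`,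
where the series converges absolutely for all `z` and
`(q;q)_n = ∏_{k=1}^{n} (1 - q^k) ≠ 0` for all `n`. -/
theorem pochhammer_infinite_product_taylor_expansion
    (q : ℂ) (hq : ‖q‖ < 1) (z : ℂ) :
    (∀ n : ℕ, (∏ k ∈ Finset.range n, (1 - q ^ (k + 1))) ≠ 0) ∧
    Summable (fun n : ℕ =>
      ‖((-1 : ℂ) ^ n * q ^ (n * (n - 1) / 2) /
          ∏ k ∈ Finset.range n, (1 - q ^ (k + 1))) * z ^ n‖) ∧
    HasSum (fun n : ℕ =>
        ((-1 : ℂ) ^ n * q ^ (n * (n - 1) / 2) /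
          ∏ k ∈ Finset.range n, (1 - q ^ (k + 1))) * z ^ n)
      (∏' n : ℕ, (1 - z * q ^ n)) := by
  have hsum := summable_norm_qEulerCoeff_mul_pow hq z
  refine ⟨fun n => Finset.prod_ne_zero_iff.mpr fun k _ => one_sub_pow_succ_ne_zero hq k, hsum, ?_⟩
  rw [← tsum_qEulerCoeff_eq_tprod hq z]
  exact hsum.of_norm.hasSum
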